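/- The abstraction function α(C) = (AND of all elements of C, (AND of all elements of C) XOR (OR of all elements of C)) applied to a nonempty finite set C of n-bit values yields a well-formed tnum whose concretization contains C, i.e., C ⊆ γ(α(C)). -/

import Mathlib

/-- A tnum is a pair (value, mask) of n-bit bitvectors. -/
abbrev Tnum (n : ℕ) := BitVec n × BitVec n

/-- A tnum is well-formed if no bit is both a known-1 and unknown. -/
def Tnum.wf {n : ℕ} (P : Tnum n) : Prop := P.1 &&& P.2 = 0#n

/-- Concretization of a tnum. -/
def Tnum.gamma {n : ℕ} (P : Tnum n) : Set (BitVec n) := { x | x &&& ~~~P.2 = P.1 }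
/-- Bitwise-and of all elements of a finite set. -/
def alphaAnd {n : ℕ} (C : Finset (BitVec n)) : BitVec n := C.fold (· &&& ·) (BitVec.allOnes n) id

/-- Bitwise-or of all elements of a finite set. -/
def alphaOr {n : ℕ} (C : Finset (BitVec n)) : BitVec n := C.fold (· ||| ·) (0#n) id

/-- The tnum abstraction function. -/
def alpha {n : ℕ} (C : Finset (BitVec n)) : Tnum n := (alphaAnd C, alphaAnd C ^^^ alphaOr C)

theorem alphaAnd_le {n : ℕ} (C : Finset (BitVec n)) (x : BitVec n) (hx : x ∈ C) (i : ℕ)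
    (h : (alphaAnd C).getLsbD i = true) : x.getLsbD i = true := by
  classical
  unfold alphaAnd at h
  rw [← Finset.insert_erase hx, Finset.fold_insert (Finset.notMem_erase x C)] at h
  simp only [id, BitVec.getLsbD_and, Bool.and_eq_true] at h
  exact h.1

theorem le_alphaOr {n : ℕ} (C : Finset (BitVec n)) (x : BitVec n) (hx : x ∈ C) (i : ℕ)
    (h : x.getLsbD i = true) : (alphaOr C).getLsbD i = true := by
  classical
  unfold alphaOr
  rw [← Finset.insert_erase hx, Finset.fold_insert (Finset.notMem_erase x C)]
  simp only [id, BitVec.getLsbD_or, h, Bool.true_or]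

theorem stmt3 {n : ℕ} (C : Finset (BitVec n)) (hC : C.Nonempty) :
    Tnum.wf (alpha C) ∧ ∀ x ∈ C, x ∈ Tnum.gamma (alpha C) := by
  constructor
  · obtain ⟨x, hx⟩ := hC
    unfold Tnum.wf alpha
    apply BitVec.eq_of_getLsbD_eq
    intro i hi
    have h1 := alphaAnd_le C x hx i
    have h2 := le_alphaOr C x hx i
    simp only [BitVec.getLsbD_and, BitVec.getLsbD_xor, BitVec.getLsbD_zero]
    revert h1 h2
    cases (alphaAnd C).getLsbD i <;> cases (alphaOr C).getLsbD i <;> cases x.getLsbD i <;> simp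
  · intro x hx
    unfold Tnum.gamma alpha
    rw [Set.mem_setOf_eq]
    apply BitVec.eq_of_getLsbD_eq
    intro i hi
    have h1 := alphaAnd_le C x hx i
    have h2 := le_alphaOr C x hx i
    simp only [BitVec.getLsbD_and, BitVec.getLsbD_xor, BitVec.getLsbD_not, hi, decide_true,
      Bool.true_and]
    revert h1 h2
    cases (alphaAnd C).getLsbD i <;> cases (alphaOr C).getLsbD i <;> cases x.getLsbD i <;> simp
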